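/- Let (c₁, c₂, Φ, u) be a smooth nonnegative solution of the time-dependent NPS system and (c₁*, c₂*, Φ*, u*) a smooth nonnegative steady-state solution, both with the same boundary conditions c_i|∂Ω = γᵢ, Φ|∂Ω = W, u|∂Ω = 0. Then there is a constant C > 0, depending only on the parameters and the domain, such that for all t: (1/2) d/dt ‖u(t) − u*‖²_{L²(Ω)} + ν‖∇(u(t) − u*)‖²_{L²(Ω)} ≤ C (‖c₁(t)‖_{L∞} + ‖c₂(t)‖_{L∞} + ‖∇Φ*‖_{L∞}) (‖c₁(t) − c₁*‖_{L²} + ‖c₂(t) − c₂*‖_{L²}) ‖∇(u(t) − u*)‖_{L²}. -/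

import Mathlib

open MeasureTheory Real Filter Topology
open scoped RealInnerProductSpace

noncomputable section

/-- Euclidean space `ℝ^d`. -/
abbrev Euc (d : ℕ) := EuclideanSpace ℝ (Fin d)

/-- Divergence of a vector field on Euclidean space. -/
def vdiv {d : ℕ} (v : Euc d → Euc d) (x : Euc d) : ℝ :=
  ∑ i, fderiv ℝ v x (EuclideanSpace.single i 1) i

/-- Laplacian of a scalar field, as the divergence of the gradient. -/
def lap {d : ℕ} (f : Euc d → ℝ) : Euc d → ℝ :=
  vdiv (fun y => gradient f y)

/-- Supremum of the pointwise norm over a set (the `L^∞` norm over `s`). -/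
def supOn {d : ℕ} {F : Type*} [NormedAddCommGroup F] (f : Euc d → F)
    (s : Set (Euc d)) : ℝ :=
  sSup ((fun x => ‖f x‖) '' s)

/-- Smooth boundary data with positive ionic concentrations on `∂Ω`. -/
def GoodData {d : ℕ} (Ω : Set (Euc d)) (γ₁ γ₂ W : Euc d → ℝ) : Prop :=
  ContDiff ℝ (⊤ : ℕ∞) γ₁ ∧ ContDiff ℝ (⊤ : ℕ∞) γ₂ ∧ ContDiff ℝ (⊤ : ℕ∞) W ∧
    (∀ x ∈ frontier Ω, 0 < γ₁ x) ∧ (∀ x ∈ frontier Ω, 0 < γ₂ x)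

/-- `Wt` is the harmonic extension of `W` to `Ω`. -/
def IsHarmonicExt {d : ℕ} (Ω : Set (Euc d)) (W Wt : Euc d → ℝ) : Prop :=
  ContinuousOn Wt (closure Ω) ∧ ContDiffOn ℝ (⊤ : ℕ∞) Wt Ω ∧
    (∀ x ∈ Ω, lap Wt x = 0) ∧ ∀ x ∈ frontier Ω, Wt x = W x

/-- A smooth nonnegative solution of the steady-state Nernst–Planck–Stokes system on `Ω`
with Dirichlet boundary data `γ₁, γ₂, W` and no-slip boundary condition for `u`. -/
structure SteadyNPS {d : ℕ} (D₁ D₂ ε ν K : ℝ) (Ω : Set (Euc d))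
    (γ₁ γ₂ W : Euc d → ℝ) (c₁ c₂ Φ : Euc d → ℝ) (u : Euc d → Euc d) (p : Euc d → ℝ) :
    Prop where
  smooth_c₁ : ContDiffOn ℝ (⊤ : ℕ∞) c₁ (closure Ω)
  smooth_c₂ : ContDiffOn ℝ (⊤ : ℕ∞) c₂ (closure Ω)
  smooth_Φ : ContDiffOn ℝ (⊤ : ℕ∞) Φ (closure Ω)
  smooth_u : ContDiffOn ℝ (⊤ : ℕ∞) u (closure Ω)
  smooth_p : ContDiffOn ℝ (⊤ : ℕ∞) p (closure Ω)
  nonneg_c₁ : ∀ x ∈ closure Ω, 0 ≤ c₁ x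
  nonneg_c₂ : ∀ x ∈ closure Ω, 0 ≤ c₂ x
  eq_c₁ : ∀ x ∈ Ω, ⟪u x, gradient c₁ x⟫ =
      D₁ * vdiv (fun y => gradient c₁ y + c₁ y • gradient Φ y) x
  eq_c₂ : ∀ x ∈ Ω, ⟪u x, gradient c₂ x⟫ =
      D₂ * vdiv (fun y => gradient c₂ y - c₂ y • gradient Φ y) x
  eq_Φ : ∀ x ∈ Ω, -(ε * lap Φ x) = c₁ x - c₂ x
  eq_u : ∀ x ∈ Ω, ∀ i : Fin d,
      -(ν * lap (fun y => u y i) x) + gradient p x i =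
        -(K * (c₁ x - c₂ x)) * gradient Φ x i
  eq_div : ∀ x ∈ Ω, vdiv u x = 0
  bc_c₁ : ∀ x ∈ frontier Ω, c₁ x = γ₁ x
  bc_c₂ : ∀ x ∈ frontier Ω, c₂ x = γ₂ x
  bc_Φ : ∀ x ∈ frontier Ω, Φ x = W x
  bc_u : ∀ x ∈ frontier Ω, u x = 0

/-- A smooth nonnegative solution of the time-dependent Nernst–Planck–Stokes system on `Ω`
for `t ≥ 0`, with Dirichlet boundary data `γ₁, γ₂, W` and no-slip boundary condition for `u`. -/
structure TimeNPS {d : ℕ} (D₁ D₂ ε ν K : ℝ) (Ω : Set (Euc d))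
    (γ₁ γ₂ W : Euc d → ℝ) (c₁ c₂ Φ : ℝ → Euc d → ℝ)
    (u : ℝ → Euc d → Euc d) (p : ℝ → Euc d → ℝ) : Prop where
  smooth_c₁ : ContDiffOn ℝ (⊤ : ℕ∞) (fun q : ℝ × Euc d => c₁ q.1 q.2)
      (Set.Ici 0 ×ˢ closure Ω)
  smooth_c₂ : ContDiffOn ℝ (⊤ : ℕ∞) (fun q : ℝ × Euc d => c₂ q.1 q.2)
      (Set.Ici 0 ×ˢ closure Ω)
  smooth_Φ : ContDiffOn ℝ (⊤ : ℕ∞) (fun q : ℝ × Euc d => Φ q.1 q.2)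
      (Set.Ici 0 ×ˢ closure Ω)
  smooth_u : ContDiffOn ℝ (⊤ : ℕ∞) (fun q : ℝ × Euc d => u q.1 q.2)
      (Set.Ici 0 ×ˢ closure Ω)
  smooth_p : ContDiffOn ℝ (⊤ : ℕ∞) (fun q : ℝ × Euc d => p q.1 q.2)
      (Set.Ici 0 ×ˢ closure Ω)
  nonneg_c₁ : ∀ t ≥ (0 : ℝ), ∀ x ∈ closure Ω, 0 ≤ c₁ t x
  nonneg_c₂ : ∀ t ≥ (0 : ℝ), ∀ x ∈ closure Ω, 0 ≤ c₂ t x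
  eq_c₁ : ∀ t > (0 : ℝ), ∀ x ∈ Ω,
      deriv (fun s => c₁ s x) t + ⟪u t x, gradient (c₁ t) x⟫ =
        D₁ * vdiv (fun y => gradient (c₁ t) y + c₁ t y • gradient (Φ t) y) x
  eq_c₂ : ∀ t > (0 : ℝ), ∀ x ∈ Ω,
      deriv (fun s => c₂ s x) t + ⟪u t x, gradient (c₂ t) x⟫ =
        D₂ * vdiv (fun y => gradient (c₂ t) y - c₂ t y • gradient (Φ t) y) x
  eq_Φ : ∀ t ≥ (0 : ℝ), ∀ x ∈ Ω, -(ε * lap (Φ t) x) = c₁ t x - c₂ t x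
  eq_u : ∀ t > (0 : ℝ), ∀ x ∈ Ω, ∀ i : Fin d,
      deriv (fun s => u s x i) t - ν * lap (fun y => u t y i) x + gradient (p t) x i =
        -(K * (c₁ t x - c₂ t x)) * gradient (Φ t) x i
  eq_div : ∀ t ≥ (0 : ℝ), ∀ x ∈ Ω, vdiv (u t) x = 0
  bc_c₁ : ∀ t ≥ (0 : ℝ), ∀ x ∈ frontier Ω, c₁ t x = γ₁ x
  bc_c₂ : ∀ t ≥ (0 : ℝ), ∀ x ∈ frontier Ω, c₂ t x = γ₂ x
  bc_Φ : ∀ t ≥ (0 : ℝ), ∀ x ∈ frontier Ω, Φ t x = W x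
  bc_u : ∀ t ≥ (0 : ℝ), ∀ x ∈ frontier Ω, u t x = 0

namespace NPSaux

theorem bdd_iter {E F : Type*} [NormedAddCommGroup E] [NormedSpace ℝ E]
    [NormedAddCommGroup F] [NormedSpace ℝ F] {f : E → F} {S K : Set E}
    (hf : ContDiffOn ℝ (⊤ : ℕ∞) f S) (hK : IsCompact K) (hKS : K ⊆ S) (k : ℕ) :
    ∃ M : ℝ, ∀ y ∈ K, y ∈ interior S → ‖iteratedFDeriv ℝ k f y‖ ≤ M := by
  refine hK.induction_on (p := fun K => ∃ M : ℝ, ∀ y ∈ K, y ∈ interior S →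
    ‖iteratedFDeriv ℝ k f y‖ ≤ M) ⟨0, by simp⟩ ?_ ?_ ?_
  · rintro s t hst ⟨M, hM⟩
    exact ⟨M, fun y hy => hM y (hst hy)⟩
  · rintro s t ⟨M, hM⟩ ⟨N, hN⟩
    refine ⟨max M N, ?_⟩
    rintro y (hy | hy) hi
    · exact (hM y hy hi).trans (le_max_left _ _)
    · exact (hN y hy hi).trans (le_max_right _ _)
  · intro x hx
    have hxS := hKS hx
    have h1 : ContDiffWithinAt ℝ (k : ℕ) f S x :=
      (hf x hxS).of_le (by exact_mod_cast le_top)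
    obtain ⟨u, hu, p, hp⟩ := h1 k le_rfl
    rw [Set.insert_eq_of_mem hxS] at hu
    have hxu : x ∈ u := mem_of_mem_nhdsWithin hxS hu
    have hc : ContinuousWithinAt (fun y => p y k) u x := (hp.cont k le_rfl) x hxu
    have hb : ∀ᶠ y in 𝓝[u] x, ‖p y k‖ < ‖p x k‖ + 1 :=
      hc.norm.eventually (gt_mem_nhds (by linarith))
    have hb' : ∀ᶠ y in 𝓝[S] x, ‖p y k‖ < ‖p x k‖ + 1 :=
      nhdsWithin_le_of_mem hu hb
    have hev : {y | y ∈ u ∧ ‖p y k‖ < ‖p x k‖ + 1} ∈ 𝓝[S] x := Filter.inter_mem hu hb'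
    obtain ⟨V, hVo, hxV, hV⟩ := mem_nhdsWithin.1 hev
    refine ⟨V ∩ K, ?_, ‖p x k‖ + 1, ?_⟩
    · rw [Set.inter_comm]; exact inter_mem_nhdsWithin _ (hVo.mem_nhds hxV)
    · rintro y ⟨hyV, hyK⟩ hyi
      have hW : IsOpen (V ∩ interior S) := hVo.inter isOpen_interior
      have hsub : V ∩ interior S ⊆ u := fun z hz => (hV ⟨hz.1, interior_subset hz.2⟩).1
      have h2 := (hp.mono hsub).eq_iteratedFDerivWithin_of_uniqueDiffOn le_rfl
        hW.uniqueDiffOn ⟨hyV, hyi⟩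
      rw [iteratedFDerivWithin_of_isOpen k hW ⟨hyV, hyi⟩] at h2
      rw [← h2]
      exact (hV ⟨hyV, interior_subset hyi⟩).2.le

variable {d : ℕ}

/-- differentiable in Ω, bounded together with the derivative -/
def Nice (Ω : Set (Euc d)) (f : Euc d → ℝ) : Prop :=
  DifferentiableOn ℝ f Ω ∧ (∃ M, ∀ x ∈ Ω, ‖f x‖ ≤ M) ∧ ∃ M, ∀ x ∈ Ω, ‖fderiv ℝ f x‖ ≤ M

def Van (Ω : Set (Euc d)) (f : Euc d → ℝ) : Prop :=
  ContinuousOn f (closure Ω) ∧ ∀ x ∈ frontier Ω, f x = 0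

def pd (i : Fin d) (f : Euc d → ℝ) (x : Euc d) : ℝ := fderiv ℝ f x (EuclideanSpace.single i 1)

theorem continuous_ext {Ω : Set (Euc d)} (hΩ : IsOpen Ω) {f h : Euc d → ℝ}
    (hf : Nice Ω f) (hv : Van Ω f) (hh : Nice Ω h) :
    Continuous (Ω.indicator (fun x => f x * h x)) := by
  rw [continuous_iff_continuousAt]
  intro x
  by_cases hx : x ∈ Ω
  · have h1 : ContinuousAt (fun x => f x * h x) x :=
      ((hf.1 x hx).continuousWithinAt.continuousAt (hΩ.mem_nhds hx)).mul
      ((hh.1 x hx).continuousWithinAt.continuousAt (hΩ.mem_nhds hx))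
    refine h1.congr ?_
    filter_upwards [hΩ.mem_nhds hx] with y hy
    rw [Set.indicator_of_mem hy]
  · by_cases hx' : x ∈ closure Ω
    · have hfr : x ∈ frontier Ω := ⟨hx', by rwa [hΩ.interior_eq]⟩
      have h0 := hv.2 x hfr
      obtain ⟨M, hM⟩ := hh.2.1
      rw [ContinuousAt, Set.indicator_of_notMem hx]
      have hfc : Tendsto f (𝓝[Ω] x) (𝓝 0) := by
        have := (hv.1 x hx').mono_left (nhdsWithin_mono x subset_closure)
        rwa [h0] at this
      have key : Tendsto (Ω.indicator (fun x => f x * h x)) (𝓝[Ω] x) (𝓝 0) := by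
        refine squeeze_zero_norm' (a := fun y => ‖f y‖ * M) ?_ ?_
        · filter_upwards [self_mem_nhdsWithin] with y hy
          rw [Set.indicator_of_mem hy, norm_mul]
          exact mul_le_mul_of_nonneg_left (hM y hy) (norm_nonneg _)
        · simpa using hfc.norm.mul_const M
      have key2 : Tendsto (Ω.indicator (fun x => f x * h x)) (𝓝[Ωᶜ] x) (𝓝 0) := by
        refine tendsto_const_nhds.congr' ?_
        filter_upwards [self_mem_nhdsWithin] with y hy
        rw [Set.indicator_of_notMem hy]
      have := key.sup key2
      rwa [← nhdsWithin_union, Set.union_compl_self, nhdsWithin_univ] at this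
    · refine (continuousAt_const (y := (0:ℝ))).congr ?_
      filter_upwards [isClosed_closure.isOpen_compl.mem_nhds hx'] with y hy
      rw [Set.indicator_of_notMem (fun h => hy (subset_closure h))]

/-- a continuous function vanishing off Ω with bounded derivative in Ω is Lipschitz -/
theorem lip_ext {Ω : Set (Euc d)} (hΩ : IsOpen Ω) {F : Euc d → ℝ} (hc : Continuous F)
    (h0 : ∀ x ∉ Ω, F x = 0) (hd : ∀ x ∈ Ω, DifferentiableAt ℝ F x) {L : NNReal}
    (hL : ∀ x ∈ Ω, ‖fderiv ℝ F x‖ ≤ L) : LipschitzWith (2 * L) F := by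
  have line : ∀ x y : Euc d, ∀ s ∈ Set.Icc (0:ℝ) 1,
      (∀ r ∈ Set.Ico (0:ℝ) s, x + r • (y - x) ∈ Ω) →
      ‖F (x + s • (y - x)) - F x‖ ≤ L * ‖y - x‖ := by
    intro x y s hs hr
    have hcont : Continuous fun r : ℝ => F (x + r • (y - x)) := by fun_prop
    have := norm_image_sub_le_of_norm_deriv_right_le_segment (a := 0) (b := s)
      (f := fun r : ℝ => F (x + r • (y - x)))
      (f' := fun r => fderiv ℝ F (x + r • (y - x)) (y - x)) (C := L * ‖y - x‖)
      hcont.continuousOn ?_ ?_ s ⟨hs.1, le_rfl⟩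
    · simp only [zero_smul, add_zero, sub_zero] at this
      refine this.trans ?_
      have : 0 ≤ (L:ℝ) * ‖y - x‖ := by positivity
      nlinarith [hs.2]
    · intro r hr'
      have h1 : HasDerivAt (fun r : ℝ => x + r • (y - x)) (y - x) r := by
        simpa using ((hasDerivAt_id r).smul_const (y - x)).const_add x
      exact ((hd _ (hr r hr')).hasFDerivAt.comp_hasDerivAt r h1).hasDerivWithinAt
    · intro r hr'
      refine (ContinuousLinearMap.le_opNorm _ _).trans ?_
      exact mul_le_mul_of_nonneg_right (hL _ (hr r hr')) (norm_nonneg _)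
  have half : ∀ x y : Euc d, (∃ r ∈ Set.Icc (0:ℝ) 1, x + r • (y - x) ∉ Ω) →
      ‖F x‖ ≤ L * ‖y - x‖ := by
    intro x y hex
    let T : Set ℝ := Set.Icc (0:ℝ) 1 ∩ (fun r : ℝ => x + r • (y - x)) ⁻¹' Ωᶜ
    have hTc : IsCompact T := isCompact_Icc.inter_right
      (hΩ.isClosed_compl.preimage (by fun_prop))
    have hTn : T.Nonempty := by
      obtain ⟨r, hr, hr'⟩ := hex
      exact ⟨r, hr, hr'⟩
    obtain ⟨s, hs, hmin⟩ := hTc.exists_isLeast hTn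
    have := line x y s hs.1 (fun r hr => by
      by_contra hcon
      have : s ≤ r := hmin ⟨⟨hr.1, hr.2.le.trans hs.1.2⟩, hcon⟩
      linarith [hr.2])
    rw [h0 _ hs.2, zero_sub, norm_neg] at this
    exact this
  refine LipschitzWith.of_dist_le_mul fun x y => ?_
  rw [dist_eq_norm, dist_eq_norm]
  push_cast
  by_cases hex : ∃ r ∈ Set.Icc (0:ℝ) 1, x + r • (y - x) ∉ Ω
  · have h1 := half x y hex
    have h2 : ‖F y‖ ≤ L * ‖x - y‖ := by
      apply half y x
      obtain ⟨r, hr, hr'⟩ := hex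
      refine ⟨1 - r, ⟨by linarith [hr.2], by linarith [hr.1]⟩, ?_⟩
      convert hr' using 2
      module
    rw [norm_sub_rev y x] at h1
    linarith [norm_sub_le (F x) (F y)]
  · push Not at hex
    have := line x y 1 ⟨zero_le_one, le_rfl⟩ (fun r hr => hex r ⟨hr.1, hr.2.le⟩)
    rw [one_smul, add_sub_cancel, norm_sub_rev, norm_sub_rev y x] at this
    have : 0 ≤ (L:ℝ) * ‖x - y‖ := by positivity
    linarith

theorem div_zero' {Ω : Set (Euc d)} (hΩ : IsOpen Ω) (hb : Bornology.IsBounded Ω)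
    {F : Euc d → ℝ} {L : NNReal} (hF : LipschitzWith L F)
    (h0 : ∀ x ∉ Ω, F x = 0) (v : Euc d) :
    ∫ x in Ω, fderiv ℝ F x v = 0 := by
  have hcs : HasCompactSupport F := by
    refine HasCompactSupport.intro (K := closure Ω) hb.isCompact_closure ?_
    intro x hx
    exact h0 x (fun h => hx (subset_closure h))
  have h1 := LipschitzWith.integral_lineDeriv_mul_eq (μ := (volume : Measure (Euc d)))
    (LipschitzWith.const (1:ℝ) : LipschitzWith 0 (fun _ : Euc d => (1:ℝ))) hF hcs (-v)
  simp only [neg_neg, mul_one] at h1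
  have h2 : ∀ x : Euc d, lineDeriv ℝ (fun _ : Euc d => (1:ℝ)) x (-v) = 0 := fun x => by
    simp [lineDeriv]
  simp only [h2, zero_mul, integral_zero] at h1
  have hae := hF.ae_differentiableAt (μ := (volume : Measure (Euc d)))
  have hmd : MeasurableSet {x | DifferentiableAt ℝ F x} := measurableSet_of_differentiableAt ℝ F
  have hz : ∀ᵐ x ∂(volume : Measure (Euc d)), x ∉ Ω → fderiv ℝ F x v = 0 := by
    by_cases hv : v = 0
    · simp [hv]
    have hms : MeasurableSet (Ωᶜ ∩ {x | DifferentiableAt ℝ F x}) :=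
      hΩ.measurableSet.compl.inter hmd
    have hap : ApproximatesLinearOn (fun x => F x • v) (0 : Euc d →L[ℝ] Euc d)
        (Ωᶜ ∩ {x | DifferentiableAt ℝ F x}) 0 := by
      intro x hx y hy
      simp [h0 x hx.1, h0 y hy.1]
    have := hap.norm_fderiv_sub_le (volume : Measure (Euc d)) hms
      (fun x => (fderiv ℝ F x).smulRight v) (fun x hx =>
        (hx.2.hasFDerivAt.smul_const v).hasFDerivWithinAt)
    rw [ae_restrict_iff' hms] at this
    filter_upwards [this, hae] with x hx hdx hxΩ
    have h3 := hx ⟨hxΩ, hdx⟩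
    have h4 : fderiv ℝ F x = 0 ∨ v = 0 := by simpa using h3
    rw [h4.resolve_right hv]
    rfl
  have h3 : ∫ x, lineDeriv ℝ F x v = ∫ x, Ω.indicator (fun x => fderiv ℝ F x v) x := by
    refine integral_congr_ae ?_
    filter_upwards [hz, hae] with x hx hdx
    rw [hdx.lineDeriv_eq_fderiv]
    by_cases hxΩ : x ∈ Ω
    · rw [Set.indicator_of_mem hxΩ]
    · rw [Set.indicator_of_notMem hxΩ, hx hxΩ]
  rw [integral_indicator hΩ.measurableSet] at h3
  rw [← h3, ← h1]

/-- bounded measurable functions on Ω -/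
def BM (Ω : Set (Euc d)) (f : Euc d → ℝ) : Prop :=
  AEStronglyMeasurable f (volume.restrict Ω) ∧ ∃ M, ∀ x ∈ Ω, ‖f x‖ ≤ M

section BM
variable {Ω : Set (Euc d)} {f g : Euc d → ℝ}

theorem BM.int (hf : BM Ω f) (hΩ : IsOpen Ω) (hb : Bornology.IsBounded Ω) :
    IntegrableOn f Ω := by
  obtain ⟨h1, M, hM⟩ := hf
  have : IsFiniteMeasure (volume.restrict Ω) := ⟨by simpa using hb.measure_lt_top⟩
  refine Integrable.of_bound h1 M ?_
  rw [ae_restrict_iff' hΩ.measurableSet]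
  exact Eventually.of_forall hM

theorem BM.mul (hf : BM Ω f) (hg : BM Ω g) : BM Ω (fun x => f x * g x) := by
  obtain ⟨h1, M, hM⟩ := hf
  obtain ⟨h2, N, hN⟩ := hg
  refine ⟨h1.mul h2, M * N, fun x hx => ?_⟩
  rw [norm_mul]
  exact mul_le_mul (hM x hx) (hN x hx) (norm_nonneg _) ((norm_nonneg _).trans (hM x hx))

theorem BM.add (hf : BM Ω f) (hg : BM Ω g) : BM Ω (fun x => f x + g x) := by
  obtain ⟨h1, M, hM⟩ := hf
  obtain ⟨h2, N, hN⟩ := hg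
  exact ⟨h1.add h2, M + N, fun x hx => (norm_add_le _ _).trans (add_le_add (hM x hx) (hN x hx))⟩

theorem BM.sub (hf : BM Ω f) (hg : BM Ω g) : BM Ω (fun x => f x - g x) := by
  obtain ⟨h1, M, hM⟩ := hf
  obtain ⟨h2, N, hN⟩ := hg
  exact ⟨h1.sub h2, M + N, fun x hx => (norm_sub_le _ _).trans (add_le_add (hM x hx) (hN x hx))⟩

theorem BM.neg (hf : BM Ω f) : BM Ω (fun x => - f x) := by
  obtain ⟨h1, M, hM⟩ := hf
  exact ⟨h1.neg, M, fun x hx => by simpa using hM x hx⟩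

theorem BM.abs (hf : BM Ω f) : BM Ω (fun x => |f x|) := by
  obtain ⟨h1, M, hM⟩ := hf
  exact ⟨h1.norm, M, fun x hx => by simpa using hM x hx⟩

theorem BM.sqrt (hf : BM Ω f) : BM Ω (fun x => √(f x)) := by
  obtain ⟨h1, M, hM⟩ := hf
  refine ⟨Real.continuous_sqrt.comp_aestronglyMeasurable h1, √M, fun x hx => ?_⟩
  rw [Real.norm_of_nonneg (Real.sqrt_nonneg _)]
  exact Real.sqrt_le_sqrt ((le_abs_self _).trans (hM x hx))

theorem BM.const (c : ℝ) : BM Ω (fun _ => c) :=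
  ⟨aestronglyMeasurable_const, ‖c‖, fun _ _ => le_rfl⟩

theorem BM.sum {ι : Type*} (s : Finset ι) {f : ι → Euc d → ℝ} (hf : ∀ i ∈ s, BM Ω (f i)) :
    BM Ω (fun x => ∑ i ∈ s, f i x) := by
  classical
  induction s using Finset.induction_on with
  | empty => simpa using BM.const (Ω := Ω) 0
  | insert a s ha ih =>
    simp only [Finset.sum_insert ha]
    exact (hf a (by simp)).add (ih fun i hi => hf i (by simp [hi]))

theorem BM.sq (hf : BM Ω f) : BM Ω (fun x => f x ^ 2) := by
  simpa only [pow_two] using hf.mul hf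

theorem Nice.bm (hf : Nice Ω f) (hΩ : IsOpen Ω) : BM Ω f :=
  ⟨hf.1.continuousOn.aestronglyMeasurable hΩ.measurableSet, hf.2.1⟩

theorem Nice.bm_pd (hf : Nice Ω f) (i : Fin d) : BM Ω (pd i f) := by
  obtain ⟨M, hM⟩ := hf.2.2
  refine ⟨(measurable_fderiv_apply_const ℝ f _).aestronglyMeasurable, M, fun x hx => ?_⟩
  refine (ContinuousLinearMap.le_opNorm _ _).trans ?_
  simpa using hM x hx

theorem Nice.diffAt (hf : Nice Ω f) (hΩ : IsOpen Ω) {x : Euc d} (hx : x ∈ Ω) :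
    DifferentiableAt ℝ f x := (hf.1 x hx).differentiableAt (hΩ.mem_nhds hx)

theorem Nice.mul (hf : Nice Ω f) (hg : Nice Ω g) (hΩ : IsOpen Ω) :
    Nice Ω (fun x => f x * g x) := by
  have hf' := hf
  have hg' := hg
  obtain ⟨h1, ⟨M, hM⟩, ⟨M', hM'⟩⟩ := hf
  obtain ⟨h2, ⟨N, hN⟩, ⟨N', hN'⟩⟩ := hg
  refine ⟨h1.mul h2, ⟨M * N, fun x hx => ?_⟩, ⟨M * N' + N * M', fun x hx => ?_⟩⟩
  · rw [norm_mul]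
    exact mul_le_mul (hM x hx) (hN x hx) (norm_nonneg _) ((norm_nonneg _).trans (hM x hx))
  · rw [fderiv_fun_mul (hf'.diffAt hΩ hx) (hg'.diffAt hΩ hx)]
    refine (norm_add_le _ _).trans ?_
    rw [norm_smul, norm_smul]
    exact add_le_add (mul_le_mul (hM x hx) (hN' x hx) (norm_nonneg _) ((norm_nonneg _).trans (hM x hx)))
      (mul_le_mul (hN x hx) (hM' x hx) (norm_nonneg _) ((norm_nonneg _).trans (hN x hx)))

theorem Nice.sub (hf : Nice Ω f) (hg : Nice Ω g) (hΩ : IsOpen Ω) :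
    Nice Ω (fun x => f x - g x) := by
  have hf' := hf
  have hg' := hg
  obtain ⟨h1, ⟨M, hM⟩, ⟨M', hM'⟩⟩ := hf
  obtain ⟨h2, ⟨N, hN⟩, ⟨N', hN'⟩⟩ := hg
  refine ⟨h1.sub h2, ⟨M + N, fun x hx => ?_⟩, ⟨M' + N', fun x hx => ?_⟩⟩
  · exact (norm_sub_le _ _).trans (add_le_add (hM x hx) (hN x hx))
  · rw [fderiv_fun_sub (hf'.diffAt hΩ hx) (hg'.diffAt hΩ hx)]
    exact (norm_sub_le _ _).trans (add_le_add (hM' x hx) (hN' x hx))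

theorem pd_mul (hf : Nice Ω f) (hg : Nice Ω g) (hΩ : IsOpen Ω) (i : Fin d) {x : Euc d}
    (hx : x ∈ Ω) : pd i (fun x => f x * g x) x = f x * pd i g x + pd i f x * g x := by
  simp only [pd]
  rw [fderiv_fun_mul (hf.diffAt hΩ hx) (hg.diffAt hΩ hx)]
  simp [mul_comm]

theorem pd_sub (hf : Nice Ω f) (hg : Nice Ω g) (hΩ : IsOpen Ω) (i : Fin d) {x : Euc d}
    (hx : x ∈ Ω) : pd i (fun x => f x - g x) x = pd i f x - pd i g x := by
  simp only [pd]
  rw [fderiv_fun_sub (hf.diffAt hΩ hx) (hg.diffAt hΩ hx)]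
  simp

end BM

theorem ibp {Ω : Set (Euc d)} (hΩ : IsOpen Ω) (hb : Bornology.IsBounded Ω) {f h : Euc d → ℝ}
    (hf : Nice Ω f) (hv : Van Ω f) (hh : Nice Ω h) (i : Fin d) :
    ∫ x in Ω, f x * pd i h x = - ∫ x in Ω, pd i f x * h x := by
  have hp := hf.mul hh hΩ
  have hEq : ∀ x ∈ Ω, Ω.indicator (fun x => f x * h x) =ᶠ[𝓝 x] (fun x => f x * h x) := by
    intro x hx
    filter_upwards [hΩ.mem_nhds hx] with y hy
    rw [Set.indicator_of_mem hy]
  obtain ⟨M, hM⟩ := hp.2.2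
  have hlip := lip_ext hΩ (continuous_ext hΩ hf hv hh) (fun x hx => Set.indicator_of_notMem hx _)
    (fun x hx => (hp.diffAt hΩ hx).congr_of_eventuallyEq (hEq x hx)) (L := M.toNNReal)
    (fun x hx => by
      rw [(hEq x hx).fderiv_eq]
      exact (hM x hx).trans (Real.le_coe_toNNReal M))
  have h0 := div_zero' hΩ hb hlip (fun x hx => Set.indicator_of_notMem hx _)
    (EuclideanSpace.single i 1)
  have h1 : ∫ x in Ω, fderiv ℝ (Ω.indicator (fun x => f x * h x)) x (EuclideanSpace.single i 1)
      = ∫ x in Ω, (f x * pd i h x + pd i f x * h x) := by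
    refine setIntegral_congr_fun hΩ.measurableSet fun x hx => ?_
    rw [(hEq x hx).fderiv_eq, ← pd_mul hf hh hΩ i hx]
    rfl
  rw [h1, integral_add (((hf.bm hΩ).mul (hh.bm_pd i)).int hΩ hb)
    (((hf.bm_pd i).mul (hh.bm hΩ)).int hΩ hb)] at h0
  linarith

end NPSaux

namespace NPSaux
variable {d : ℕ}

theorem norm_fderiv_bdd {E F : Type*} [NormedAddCommGroup E] [NormedSpace ℝ E]
    [NormedAddCommGroup F] [NormedSpace ℝ F] {f : E → F} {S K : Set E}
    (hf : ContDiffOn ℝ (⊤ : ℕ∞) f S) (hK : IsCompact K) (hKS : K ⊆ S) :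
    ∃ M : ℝ, ∀ y ∈ K, y ∈ interior S → ‖fderiv ℝ f y‖ ≤ M := by
  obtain ⟨M, hM⟩ := bdd_iter hf hK hKS 1
  exact ⟨M, fun y hy hi => by simpa [norm_iteratedFDeriv_one] using hM y hy hi⟩

section
variable {Ω : Set (Euc d)} {f g : Euc d → ℝ}

theorem sub_int (hΩ : IsOpen Ω) : Ω ⊆ interior (closure Ω) :=
  interior_maximal subset_closure hΩ

theorem nice_of_smooth (hΩ : IsOpen Ω) (hb : Bornology.IsBounded Ω)
    (hf : ContDiffOn ℝ (⊤ : ℕ∞) f (closure Ω)) : Nice Ω f := by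
  refine ⟨(hf.mono subset_closure).differentiableOn (by simp), ?_, ?_⟩
  · obtain ⟨M, hM⟩ := hb.isCompact_closure.exists_bound_of_continuousOn hf.continuousOn
    exact ⟨M, fun x hx => hM x (subset_closure hx)⟩
  · obtain ⟨M, hM⟩ := norm_fderiv_bdd hf hb.isCompact_closure subset_rfl
    exact ⟨M, fun x hx => hM x (subset_closure hx) (sub_int hΩ hx)⟩

theorem diff_fderiv (hΩ : IsOpen Ω)
    (hf : ContDiffOn ℝ (⊤ : ℕ∞) f (closure Ω)) {x : Euc d} (hx : x ∈ Ω) :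
    DifferentiableAt ℝ (fderiv ℝ f) x := by
  have h1 : ContDiffAt ℝ (⊤ : ℕ∞) f x :=
    (hf x (subset_closure hx)).contDiffAt (mem_of_superset (hΩ.mem_nhds hx) subset_closure)
  have h2 : ContDiffAt ℝ 1 (fderiv ℝ f) x := h1.fderiv_right (by norm_cast)
  exact h2.differentiableAt (by simp)

theorem nice_pd (hΩ : IsOpen Ω) (hb : Bornology.IsBounded Ω)
    (hf : ContDiffOn ℝ (⊤ : ℕ∞) f (closure Ω)) (i : Fin d) : Nice Ω (pd i f) := by
  have hn := nice_of_smooth hΩ hb hf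
  have hd : ∀ x ∈ Ω, HasFDerivAt (pd i f)
      ((ContinuousLinearMap.apply ℝ ℝ (EuclideanSpace.single i (1:ℝ))).comp
        (fderiv ℝ (fderiv ℝ f) x)) x := by
    intro x hx
    exact (ContinuousLinearMap.apply ℝ ℝ (EuclideanSpace.single i (1:ℝ))).hasFDerivAt.comp x
      (diff_fderiv hΩ hf hx).hasFDerivAt
  refine ⟨fun x hx => (hd x hx).differentiableAt.differentiableWithinAt, (hn.bm_pd i).2, ?_⟩
  obtain ⟨M, hM⟩ := bdd_iter hf hb.isCompact_closure subset_rfl 2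
  refine ⟨‖ContinuousLinearMap.apply ℝ ℝ (EuclideanSpace.single i (1:ℝ) : Euc d)‖ * M, fun x hx => ?_⟩
  rw [(hd x hx).fderiv]
  refine (ContinuousLinearMap.opNorm_comp_le _ _).trans ?_
  refine mul_le_mul_of_nonneg_left ?_ (norm_nonneg _)
  have := hM x (subset_closure hx) (sub_int hΩ hx)
  rwa [← norm_iteratedFDeriv_fderiv, norm_iteratedFDeriv_one] at this

theorem gradient_apply (x : Euc d) (i : Fin d) : gradient f x i = pd i f x := by
  have := InnerProductSpace.toDual_symm_apply (𝕜 := ℝ) (x := (EuclideanSpace.single i (1:ℝ) : Euc d))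
    (y := fderiv ℝ f x)
  rw [pd, ← this, real_inner_comm]
  simp [gradient, EuclideanSpace.inner_single_left]

theorem lap_eq (hΩ : IsOpen Ω)
    (hf : ContDiffOn ℝ (⊤ : ℕ∞) f (closure Ω)) {x : Euc d} (hx : x ∈ Ω) :
    lap f x = ∑ i, pd i (pd i f) x := by
  unfold lap vdiv
  refine Finset.sum_congr rfl fun i _ => ?_
  have h1 := diff_fderiv hΩ hf hx
  have h2 : DifferentiableAt ℝ (fun y => gradient f y) x := by
    rw [differentiableAt_euclidean]
    intro k
    have h4 : (fun y => gradient f y k) = pd k f := by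
      ext y; exact gradient_apply y k
    rw [h4]
    exact (ContinuousLinearMap.apply ℝ ℝ
      (EuclideanSpace.single k (1:ℝ) : Euc d)).differentiableAt.comp x h1
  have h3 : HasFDerivAt (fun y => gradient f y i)
      ((EuclideanSpace.proj i : Euc d →L[ℝ] ℝ).comp (fderiv ℝ (fun y => gradient f y) x)) x :=
    (EuclideanSpace.proj i : Euc d →L[ℝ] ℝ).hasFDerivAt.comp x h2.hasFDerivAt
  have h4 : (fun y => gradient f y i) = pd i f := by
    ext y; exact gradient_apply y i
  rw [h4] at h3
  conv_rhs => rw [pd, h3.fderiv]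
  rfl

theorem pd_comp {v : Euc d → Euc d} {x : Euc d} (hv : DifferentiableAt ℝ v x) (i j : Fin d) :
    pd j (fun y => v y i) x = fderiv ℝ v x (EuclideanSpace.single j 1) i := by
  have h3 : HasFDerivAt (fun y => v y i)
      ((EuclideanSpace.proj i : Euc d →L[ℝ] ℝ).comp (fderiv ℝ v x)) x :=
    (EuclideanSpace.proj i : Euc d →L[ℝ] ℝ).hasFDerivAt.comp x hv.hasFDerivAt
  rw [pd, h3.fderiv]
  rfl

theorem opnorm_le (A : Euc d →L[ℝ] Euc d) :
    ‖A‖ ^ 2 ≤ ∑ i, ∑ j, (A (EuclideanSpace.single j 1) i) ^ 2 := by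
  have hS : 0 ≤ ∑ i, ∑ j, (A (EuclideanSpace.single j 1) i) ^ 2 := by positivity
  have : ‖A‖ ≤ √(∑ i, ∑ j, (A (EuclideanSpace.single j 1) i) ^ 2) := by
    refine A.opNorm_le_bound (Real.sqrt_nonneg _) fun v => ?_
    have hv : v = ∑ j, v j • (EuclideanSpace.single j (1:ℝ) : Euc d) := by
      ext k; simp [Pi.single_apply]
    refine le_of_sq_le_sq ?_ (by positivity)
    rw [mul_pow, Real.sq_sqrt hS, EuclideanSpace.real_norm_sq_eq, EuclideanSpace.real_norm_sq_eq,
      Finset.sum_mul]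
    refine Finset.sum_le_sum fun i _ => ?_
    have : A v i = ∑ j, A (EuclideanSpace.single j 1) i * v j := by
      conv_lhs => rw [hv]
      simp [map_sum, mul_comm]
    rw [this]
    exact Finset.sum_mul_sq_le_sq_mul_sq _ _ _
  calc ‖A‖ ^ 2 ≤ (√(∑ i, ∑ j, (A (EuclideanSpace.single j 1) i) ^ 2)) ^ 2 :=
        pow_le_pow_left₀ (norm_nonneg _) this 2
    _ = _ := Real.sq_sqrt hS

theorem le_opnorm_col (A : Euc d →L[ℝ] Euc d) (j : Fin d) :
    ∑ i, (A (EuclideanSpace.single j 1) i) ^ 2 ≤ ‖A‖ ^ 2 := by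
  rw [← EuclideanSpace.real_norm_sq_eq]
  have := A.le_opNorm (EuclideanSpace.single j 1)
  simp only [PiLp.norm_single, norm_one, mul_one] at this
  exact pow_le_pow_left₀ (norm_nonneg _) this 2

theorem cs (hΩ : IsOpen Ω) (hb : Bornology.IsBounded Ω) (hf : BM Ω f) (hg : BM Ω g) :
    ∫ x in Ω, f x * g x ≤ √(∫ x in Ω, f x ^ 2) * √(∫ x in Ω, g x ^ 2) := by
  set a := ∫ x in Ω, f x ^ 2 with ha
  set b := ∫ x in Ω, g x ^ 2 with hb'
  set m := ∫ x in Ω, f x * g x with hm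
  have ha0 : 0 ≤ a := integral_nonneg fun x => sq_nonneg _
  have hb0 : 0 ≤ b := integral_nonneg fun x => sq_nonneg _
  have key : ∀ s : ℝ, 0 ≤ b * (s * s) + (2 * m) * s + a := by
    intro s
    have h0 : 0 ≤ ∫ x in Ω, (f x + s * g x) ^ 2 := integral_nonneg fun x => sq_nonneg _
    have h1 : ∫ x in Ω, (f x + s * g x) ^ 2 = ∫ x in Ω, ((f x ^ 2 + (2 * s) * (f x * g x)) + (s*s) * g x ^ 2) := by
      congr 1; ext x; ring
    have i1 := hf.sq.int hΩ hb
    have i2 := ((hf.mul hg).int hΩ hb).const_mul (2 * s)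
    have i3 := (hg.sq.int hΩ hb).const_mul (s * s)
    have i12 : IntegrableOn (fun x => f x ^ 2 + 2 * s * (f x * g x)) Ω := i1.add i2
    rw [h1, integral_add i12 i3, integral_add i1 i2, integral_const_mul,
      integral_const_mul, ← ha, ← hb', ← hm] at h0
    linarith
  have := discrim_le_zero key
  rw [discrim] at this
  rw [← Real.sqrt_mul ha0]
  refine Real.le_sqrt_of_sq_le ?_
  nlinarith

theorem minkowski (hΩ : IsOpen Ω) (hb : Bornology.IsBounded Ω) (hf : BM Ω f) (hg : BM Ω g) :
    √(∫ x in Ω, (f x - g x) ^ 2) ≤ √(∫ x in Ω, f x ^ 2) + √(∫ x in Ω, g x ^ 2) := by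
  have h := cs hΩ hb hf hg.neg
  have ha0 : 0 ≤ ∫ x in Ω, f x ^ 2 := integral_nonneg fun x => sq_nonneg _
  have hb0 : 0 ≤ ∫ x in Ω, g x ^ 2 := integral_nonneg fun x => sq_nonneg _
  rw [Real.sqrt_le_left (by positivity)]
  simp only [neg_sq] at h
  have h1 : ∫ x in Ω, (f x - g x) ^ 2 = ∫ x in Ω, ((f x ^ 2 + 2 * (f x * -g x)) + g x ^ 2) := by
    congr 1; ext x; ring
  have i1 := hf.sq.int hΩ hb
  have i2 := ((hf.mul hg.neg).int hΩ hb).const_mul 2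
  have i3 := hg.sq.int hΩ hb
  have i12 : IntegrableOn (fun x => f x ^ 2 + 2 * (f x * -g x)) Ω := i1.add i2
  rw [h1, integral_add i12 i3, integral_add i1 i2, integral_const_mul, add_sq,
    Real.sq_sqrt ha0, Real.sq_sqrt hb0]
  linarith

theorem poincare (hΩ : IsOpen Ω) (hb : Bornology.IsBounded Ω) (hf : Nice Ω f) (hv : Van Ω f)
    (i : Fin d) {R : ℝ} (hR : ∀ x ∈ Ω, ‖x‖ ≤ R) :
    ∫ x in Ω, f x ^ 2 ≤ (2 * R) ^ 2 * ∫ x in Ω, pd i f x ^ 2 := by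
  have hpx : ∀ x : Euc d, HasFDerivAt (fun y : Euc d => y i) (EuclideanSpace.proj i : Euc d →L[ℝ] ℝ) x :=
    fun x => (EuclideanSpace.proj i : Euc d →L[ℝ] ℝ).hasFDerivAt
  have hpdx : ∀ x : Euc d, pd i (fun y : Euc d => y i) x = 1 := by
    intro x
    rw [pd, (hpx x).fderiv]; simp
  have hxR : ∀ x ∈ Ω, |x i| ≤ R := fun x hx => (PiLp.norm_apply_le x i).trans (hR x hx)
  have hx : Nice Ω (fun y : Euc d => y i) :=
    ⟨fun x _ => (hpx x).differentiableAt.differentiableWithinAt, ⟨R, hxR⟩,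
      ⟨‖(EuclideanSpace.proj i : Euc d →L[ℝ] ℝ)‖, fun x _ => by rw [(hpx x).fderiv]⟩⟩
  have h1 := ibp hΩ hb hf hv (hx.mul hf hΩ) i
  have h2 : ∫ x in Ω, f x * pd i (fun y : Euc d => y i * f y) x =
      ∫ x in Ω, (x i * f x * pd i f x + f x ^ 2) := by
    refine setIntegral_congr_fun hΩ.measurableSet fun x hxx => ?_
    simp only
    rw [pd_mul hx hf hΩ i hxx, hpdx]; ring
  have b1 := ((hx.bm hΩ).mul (hf.bm hΩ)).mul (hf.bm_pd i)
  have i1 := b1.int hΩ hb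
  have i2 := (hf.bm hΩ).sq.int hΩ hb
  have i3 := (hf.bm_pd i).sq.int hΩ hb
  have h3 : ∫ x in Ω, pd i f x * (x i * f x) = ∫ x in Ω, x i * f x * pd i f x := by
    congr 1; ext x; ring
  rw [h2, h3, integral_add i1 i2] at h1
  have h4 : ∫ x in Ω, (-2) * (x i * f x * pd i f x) ≤
      ∫ x in Ω, ((1/2) * f x ^ 2 + (2 * R^2) * pd i f x ^ 2) := by
    refine setIntegral_mono_on (i1.const_mul _) ((i2.const_mul _).add (i3.const_mul _))
      hΩ.measurableSet fun x hxx => ?_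
    have hsq : (x i) ^ 2 ≤ R ^ 2 := sq_le_sq' (by linarith [(abs_le.1 (hxR x hxx)).1]) (abs_le.1 (hxR x hxx)).2
    nlinarith [sq_nonneg (f x + 2 * x i * pd i f x), mul_le_mul_of_nonneg_right hsq (sq_nonneg (pd i f x))]
  rw [integral_const_mul, integral_add (i2.const_mul _) (i3.const_mul _), integral_const_mul,
    integral_const_mul] at h4
  linarith

end
end NPSaux

namespace NPSaux
variable {d : ℕ}

theorem lin4 {μ : Measure (Euc d)} {a b c e : Euc d → ℝ} (ha : Integrable a μ) (hb : Integrable b μ)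
    (hc : Integrable c μ) (he : Integrable e μ) :
    (∫ x, a x ∂μ) - (∫ x, b x ∂μ) + (∫ x, c x ∂μ) - (∫ x, e x ∂μ) =
      ∫ x, (a x - b x + c x - e x) ∂μ := by
  have h1 : Integrable (fun x => a x - b x) μ := ha.sub hb
  have h2 : Integrable (fun x => a x - b x + c x) μ := h1.add hc
  rw [integral_sub h2 he, integral_add h1 hc, integral_sub ha hb]


theorem time_deriv {Ω : Set (Euc d)} (hΩ : IsOpen Ω) (hb : Bornology.IsBounded Ω)
    {U : ℝ → Euc d → Euc d} {us : Euc d → Euc d}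
    (hU : ContDiffOn ℝ (⊤ : ℕ∞) (fun q : ℝ × Euc d => U q.1 q.2) (Set.Ici 0 ×ˢ closure Ω))
    (hus : ContDiffOn ℝ (⊤ : ℕ∞) us (closure Ω)) {t : ℝ} (ht : 0 < t) :
    (∀ i, BM Ω (fun x => deriv (fun s => U s x i) t)) ∧
    HasDerivAt (fun s => ∫ x in Ω, ‖U s x - us x‖ ^ 2)
      (∫ x in Ω, 2 * ∑ i, (U t x i - us x i) * deriv (fun s => U s x i) t) t := by
  set V : ℝ × Euc d → Euc d := fun q => U q.1 q.2 with hV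
  let S : Set (ℝ × Euc d) := Set.Ici 0 ×ˢ closure Ω
  let K : Set (ℝ × Euc d) := Set.Icc (t/2) (2*t) ×ˢ closure Ω
  have hKc : IsCompact K := isCompact_Icc.prod hb.isCompact_closure
  have hKS : K ⊆ S := Set.prod_mono (fun s hs => by
    have := hs.1
    show 0 ≤ s
    linarith) subset_rfl
  have hIntr : ∀ s > 0, ∀ x ∈ Ω, (s, x) ∈ interior S := by
    intro s hs x hx
    have ho : IsOpen (Set.Ioi (0:ℝ) ×ˢ Ω) := isOpen_Ioi.prod hΩ
    exact interior_maximal (Set.prod_mono Set.Ioi_subset_Ici_self subset_closure) ho ⟨hs, hx⟩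
  obtain ⟨M, hM⟩ := norm_fderiv_bdd hU hKc hKS
  let G : ℝ → Euc d → Euc d := fun s x => fderiv ℝ V (s, x) (1, 0)
  have hG : ∀ s > 0, ∀ x ∈ Ω, HasDerivAt (fun s => U s x) (G s x) s := by
    intro s hs x hx
    have h1 : DifferentiableAt ℝ V (s, x) :=
      ((hU (s, x) (interior_subset (hIntr s hs x hx))).contDiffAt
        (mem_interior_iff_mem_nhds.1 (hIntr s hs x hx))).differentiableAt (by simp)
    have h2 : HasDerivAt (fun s : ℝ => (s, x)) ((1:ℝ), (0 : Euc d)) s :=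
      (hasDerivAt_id s).prodMk (hasDerivAt_const s x)
    exact h1.hasFDerivAt.comp_hasDerivAt s h2
  have hGi : ∀ s > 0, ∀ x ∈ Ω, ∀ i, deriv (fun s => U s x i) s = G s x i := by
    intro s hs x hx i
    exact ((EuclideanSpace.proj i : Euc d →L[ℝ] ℝ).hasFDerivAt.comp_hasDerivAt s (hG s hs x hx)).deriv
  have hGb : ∀ s ∈ Set.Icc (t/2) (2*t), ∀ x ∈ Ω, ‖G s x‖ ≤ M := by
    intro s hs x hx
    refine (ContinuousLinearMap.le_opNorm _ _).trans ?_
    have h1 := hM (s, x) ⟨hs, subset_closure hx⟩ (hIntr s (by linarith [hs.1]) x hx)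
    have h2 : ‖((1:ℝ), (0 : Euc d))‖ = 1 := by simp [Prod.norm_def]
    rw [h2, mul_one]; exact h1
  have htI : t ∈ Set.Icc (t/2) (2*t) := ⟨by linarith, by linarith⟩
  have hGm : Measurable (G t) :=
    (measurable_fderiv_apply_const ℝ V (1, 0)).comp measurable_prodMk_left
  refine ⟨fun i => ⟨?_, M, fun x hx => ?_⟩, ?_⟩
  · have h1 : AEStronglyMeasurable (fun x => G t x i) (volume.restrict Ω) :=
      ((EuclideanSpace.proj i : Euc d →L[ℝ] ℝ).continuous.measurable.comp hGm).aestronglyMeasurable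
    refine h1.congr ?_
    rw [Filter.EventuallyEq, ae_restrict_iff' hΩ.measurableSet]
    exact Eventually.of_forall fun x hx => (hGi t ht x hx i).symm
  · beta_reduce
    rw [hGi t ht x hx i]
    exact (PiLp.norm_apply_le _ i).trans (hGb t htI x hx)
  · obtain ⟨N1, hN1⟩ := hKc.exists_bound_of_continuousOn (hU.continuousOn.mono hKS)
    obtain ⟨N2, hN2⟩ := hb.isCompact_closure.exists_bound_of_continuousOn hus.continuousOn
    have hW : ∀ s ∈ Set.Icc (t/2) (2*t), ∀ x ∈ Ω, ‖U s x - us x‖ ≤ N1 + N2 := fun s hs x hx =>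
      (norm_sub_le _ _).trans (add_le_add (hN1 (s, x) ⟨hs, subset_closure hx⟩)
        (hN2 x (subset_closure hx)))
    have hmU : ∀ s ≥ 0, AEStronglyMeasurable (fun x => U s x - us x) (volume.restrict Ω) := by
      intro s hs
      have h1 : ContinuousOn (fun x => V (s, x)) Ω :=
        hU.continuousOn.comp (by fun_prop) (fun x hx => ⟨hs, subset_closure hx⟩)
      exact (h1.sub (hus.continuousOn.mono subset_closure)).aestronglyMeasurable hΩ.measurableSet
    have hfin : IsFiniteMeasure (volume.restrict Ω) := ⟨by simpa using hb.measure_lt_top⟩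
    have key := hasDerivAt_integral_of_dominated_loc_of_deriv_le (μ := volume.restrict Ω)
      (F := fun s x => ‖U s x - us x‖ ^ 2) (F' := fun s x => 2 * ⟪U s x - us x, G s x⟫)
      (x₀ := t) (s := Set.Icc (t/2) (2*t)) (bound := fun _ => 2 * ((N1 + N2) * M))
      (Icc_mem_nhds (by linarith) (by linarith)) ?_ ?_ ?_ ?_ (integrable_const _) ?_
    · have e : ∫ x in Ω, 2 * ∑ i, (U t x i - us x i) * deriv (fun s => U s x i) t =
          ∫ x in Ω, 2 * ⟪U t x - us x, G t x⟫ := ?_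
      · rw [e]; exact key.2
      refine setIntegral_congr_fun hΩ.measurableSet fun x hx => ?_
      simp only [hGi t ht x hx, PiLp.inner_apply]
      congr 1
      refine Finset.sum_congr rfl fun i _ => ?_
      simp [mul_comm]
    · filter_upwards [Ioi_mem_nhds ht] with s hs
      exact (hmU s (le_of_lt hs)).norm.pow 2
    · refine Integrable.of_bound ((hmU t ht.le).norm.pow 2) ((N1 + N2)^2) ?_
      rw [ae_restrict_iff' hΩ.measurableSet]
      refine Eventually.of_forall fun x hx => ?_
      rw [Real.norm_of_nonneg (by positivity)]
      exact pow_le_pow_left₀ (norm_nonneg _) (hW t htI x hx) 2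
    · exact ((hmU t ht.le).inner hGm.aestronglyMeasurable).const_mul 2
    · rw [ae_restrict_iff' hΩ.measurableSet]
      refine Eventually.of_forall fun x hx s hs => ?_
      rw [norm_mul, Real.norm_of_nonneg (by norm_num : (0:ℝ) ≤ 2)]
      refine mul_le_mul_of_nonneg_left ((norm_inner_le_norm _ _).trans ?_) (by norm_num)
      exact mul_le_mul (hW s hs x hx) (hGb s hs x hx) (norm_nonneg _)
        ((norm_nonneg _).trans (hW s hs x hx))
    · rw [ae_restrict_iff' hΩ.measurableSet]
      refine Eventually.of_forall fun x hx s hs => ?_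
      exact ((hG s (by linarith [hs.1]) x hx).sub_const (us x)).norm_sq

section
variable {Ω : Set (Euc d)} {f g : Euc d → ℝ}

theorem bm_lap (hΩ : IsOpen Ω) (hb : Bornology.IsBounded Ω)
    (hg : ContDiffOn ℝ (⊤ : ℕ∞) g (closure Ω)) : BM Ω (lap g) := by
  have h := BM.sum Finset.univ (fun i _ => (nice_pd hΩ hb hg i).bm_pd i)
  refine ⟨h.1.congr ?_, ?_⟩
  · rw [Filter.EventuallyEq, ae_restrict_iff' hΩ.measurableSet]
    exact Eventually.of_forall fun x hx => (lap_eq hΩ hg hx).symm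
  · obtain ⟨M, hM⟩ := h.2
    exact ⟨M, fun x hx => by rw [lap_eq hΩ hg hx]; exact hM x hx⟩

theorem ibp_lap (hΩ : IsOpen Ω) (hb : Bornology.IsBounded Ω) (hf : Nice Ω f) (hv : Van Ω f)
    (hg : ContDiffOn ℝ (⊤ : ℕ∞) g (closure Ω)) :
    ∫ x in Ω, f x * lap g x = - ∫ x in Ω, ∑ j, pd j f x * pd j g x := by
  have hgn := nice_of_smooth hΩ hb hg
  rw [integral_finsetSum _ (fun j _ => ((hf.bm_pd j).mul (hgn.bm_pd j)).int hΩ hb)]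
  rw [← Finset.sum_neg_distrib]
  rw [setIntegral_congr_fun (g := fun x => ∑ j, f x * pd j (pd j g) x) hΩ.measurableSet
    (fun x hx => by simp only [lap_eq hΩ hg hx, Finset.mul_sum])]
  rw [integral_finsetSum _
    (fun j _ => ((hf.bm hΩ).mul ((nice_pd hΩ hb hg j).bm_pd j)).int hΩ hb)]
  exact Finset.sum_congr rfl fun j _ => ibp hΩ hb hf hv (nice_pd hΩ hb hg j) j

theorem ibp_lap_sub {g' : Euc d → ℝ} (hΩ : IsOpen Ω) (hb : Bornology.IsBounded Ω)
    (hg : ContDiffOn ℝ (⊤ : ℕ∞) g (closure Ω)) (hg' : ContDiffOn ℝ (⊤ : ℕ∞) g' (closure Ω))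
    (hv : Van Ω (fun x => g x - g' x)) :
    ∫ x in Ω, (g x - g' x) * (lap g x - lap g' x)
      = - ∫ x in Ω, ∑ j, pd j (fun x => g x - g' x) x ^ 2 := by
  have hgn := nice_of_smooth hΩ hb hg
  have hgn' := nice_of_smooth hΩ hb hg'
  have hf := hgn.sub hgn' hΩ
  have b1 := (hf.bm hΩ).mul (bm_lap hΩ hb hg)
  have b2 := (hf.bm hΩ).mul (bm_lap hΩ hb hg')
  simp only [mul_sub]
  rw [integral_sub (b1.int hΩ hb) (b2.int hΩ hb), ibp_lap hΩ hb hf hv hg, ibp_lap hΩ hb hf hv hg',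
    neg_sub_neg, ← neg_sub, ← integral_sub]
  · congr 1
    refine setIntegral_congr_fun hΩ.measurableSet fun x hx => ?_
    simp only [← Finset.sum_sub_distrib]
    refine Finset.sum_congr rfl fun j _ => ?_
    rw [pd_sub hgn hgn' hΩ j hx]; ring
  · exact (BM.sum _ fun j _ => (hf.bm_pd j).mul (hgn.bm_pd j)).int hΩ hb
  · exact (BM.sum _ fun j _ => (hf.bm_pd j).mul (hgn'.bm_pd j)).int hΩ hb

theorem elliptic {g' σ : Euc d → ℝ} (hΩ : IsOpen Ω) (hb : Bornology.IsBounded Ω)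
    (hg : ContDiffOn ℝ (⊤ : ℕ∞) g (closure Ω)) (hg' : ContDiffOn ℝ (⊤ : ℕ∞) g' (closure Ω))
    (hv : Van Ω (fun x => g x - g' x)) (hσ : BM Ω σ) {ε : ℝ} (hε : 0 < ε)
    (he : ∀ x ∈ Ω, -(ε * (lap g x - lap g' x)) = σ x) (i : Fin d) {R : ℝ} (hR0 : 0 < R)
    (hR : ∀ x ∈ Ω, ‖x‖ ≤ R) :
    √(∫ x in Ω, ∑ j, pd j (fun x => g x - g' x) x ^ 2) ≤ (2 * R) / ε * √(∫ x in Ω, σ x ^ 2) := by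
  have hgn := nice_of_smooth hΩ hb hg
  have hgn' := nice_of_smooth hΩ hb hg'
  have hf := hgn.sub hgn' hΩ
  set ψ : Euc d → ℝ := fun x => g x - g' x with hψ
  have h1 := ibp_lap_sub hΩ hb hg hg' hv
  have hP := poincare hΩ hb hf hv i hR
  have i1 := (hf.bm hΩ).sq.int hΩ hb
  have i2 := hσ.sq.int hΩ hb
  have i4 := (BM.sum Finset.univ fun j _ => (hf.bm_pd j).sq).int hΩ hb
  have i3 := (hf.bm_pd i).sq.int hΩ hb
  have hle : ∫ x in Ω, pd i ψ x ^ 2 ≤ ∫ x in Ω, ∑ j, pd j ψ x ^ 2 :=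
    setIntegral_mono_on i3 i4 hΩ.measurableSet fun x _ =>
      Finset.single_le_sum (f := fun j => pd j ψ x ^ 2) (fun j _ => sq_nonneg _) (Finset.mem_univ i)
  have h2 : ∫ x in Ω, ψ x * (lap g x - lap g' x) = ∫ x in Ω, (-1/ε) * (ψ x * σ x) := by
    refine setIntegral_congr_fun hΩ.measurableSet fun x hx => ?_
    simp only [← he x hx]
    field_simp
  have h3 := cs hΩ hb (hf.bm hΩ) hσ
  change ∫ x in Ω, ψ x * (lap g x - lap g' x) = _ at h1
  rw [h2, integral_const_mul] at h1
  set X := ∫ x in Ω, ∑ j, pd j ψ x ^ 2 with hX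
  set Y := ∫ x in Ω, ψ x ^ 2 with hY
  set Z := ∫ x in Ω, σ x ^ 2 with hZ
  set m := ∫ x in Ω, ψ x * σ x
  have hX0 : 0 ≤ X := integral_nonneg fun x => Finset.sum_nonneg fun j _ => sq_nonneg _
  have hYX : √Y ≤ 2 * R * √X := by
    rw [Real.sqrt_le_left (by positivity), mul_pow, Real.sq_sqrt hX0]
    exact hP.trans (mul_le_mul_of_nonneg_left hle (by positivity))
  have hXm : X = m / ε := by
    have : (-1/ε) * m = -(m/ε) := by ring
    linarith
  have h5 : √X * √X ≤ (2 * R / ε * √Z) * √X := by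
    rw [Real.mul_self_sqrt hX0, hXm, div_le_iff₀ hε, ← hXm]
    have : 2 * R / ε * √Z * √X * ε = 2 * R * √X * √Z := by field_simp
    rw [this]
    exact h3.trans (mul_le_mul_of_nonneg_right hYX (Real.sqrt_nonneg _))
  rcases (Real.sqrt_nonneg X).eq_or_lt with h | h
  · rw [← h]; positivity
  · exact le_of_mul_le_mul_right h5 h

theorem force (hΩ : IsOpen Ω) (hb : Bornology.IsBounded Ω) {w g h : Fin d → Euc d → ℝ}
    {ρ σ : Euc d → ℝ} (hw : ∀ i, BM Ω (w i)) (hg : ∀ i, BM Ω (g i)) (hh : ∀ i, BM Ω (h i))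
    (hρ : BM Ω ρ) (hσ : BM Ω σ) {A B : ℝ} (hA : ∀ x ∈ Ω, |ρ x| ≤ A)
    (hB : ∀ x ∈ Ω, √(∑ i, h i x ^ 2) ≤ B) :
    -∫ x in Ω, ∑ i, w i x * (ρ x * g i x + σ x * h i x) ≤
      A * (√(∫ x in Ω, ∑ i, w i x ^ 2) * √(∫ x in Ω, ∑ i, g i x ^ 2)) +
      B * (√(∫ x in Ω, ∑ i, w i x ^ 2) * √(∫ x in Ω, σ x ^ 2)) := by
  rcases Set.eq_empty_or_nonempty Ω with rfl | ⟨x0, hx0⟩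
  · simp
  have hA0 : 0 ≤ A := (abs_nonneg _).trans (hA x0 hx0)
  have hB0 : 0 ≤ B := (Real.sqrt_nonneg _).trans (hB x0 hx0)
  have bw := (BM.sum Finset.univ fun i _ => (hw i).sq).sqrt
  have bg := (BM.sum Finset.univ fun i _ => (hg i).sq).sqrt
  have hsq : ∀ (k : Fin d → Euc d → ℝ) x, √(∑ i, k i x ^ 2) ^ 2 = ∑ i, k i x ^ 2 := fun k x =>
    Real.sq_sqrt (Finset.sum_nonneg fun i _ => sq_nonneg _)
  have c1 := cs hΩ hb bw bg
  have c2 := cs hΩ hb bw hσ.abs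
  simp only [hsq, sq_abs] at c1 c2
  refine le_trans ?_ (add_le_add (mul_le_mul_of_nonneg_left c1 hA0) (mul_le_mul_of_nonneg_left c2 hB0))
  have i1 := ((bw.mul bg).int hΩ hb).const_mul A
  have i2 := ((bw.mul hσ.abs).int hΩ hb).const_mul B
  rw [← integral_neg, ← integral_const_mul, ← integral_const_mul, ← integral_add i1 i2]
  refine setIntegral_mono_on ((BM.sum Finset.univ fun i _ =>
    (hw i).mul ((hρ.mul (hg i)).add (hσ.mul (hh i)))).neg.int hΩ hb) (i1.add i2)
    hΩ.measurableSet fun x hx => ?_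
  have e1 : ∑ i, w i x * (ρ x * g i x + σ x * h i x) =
      ρ x * ∑ i, w i x * g i x + σ x * ∑ i, w i x * h i x := by
    rw [Finset.mul_sum, Finset.mul_sum, ← Finset.sum_add_distrib]
    exact Finset.sum_congr rfl fun i _ => by ring
  have csf : ∀ k : Fin d → Euc d → ℝ, |∑ i, w i x * k i x| ≤
      √(∑ i, w i x ^ 2) * √(∑ i, k i x ^ 2) := fun k => by
    rw [← Real.sqrt_mul (Finset.sum_nonneg fun i _ => sq_nonneg _)]
    exact Real.abs_le_sqrt (Finset.sum_mul_sq_le_sq_mul_sq _ _ _)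
  have a1 : |ρ x * ∑ i, w i x * g i x| ≤ A * (√(∑ i, w i x ^ 2) * √(∑ i, g i x ^ 2)) := by
    rw [abs_mul]
    exact mul_le_mul (hA x hx) (csf g) (abs_nonneg _) hA0
  have a2 : |σ x * ∑ i, w i x * h i x| ≤ B * (√(∑ i, w i x ^ 2) * |σ x|) := by
    rw [abs_mul]
    have := (csf h).trans (mul_le_mul_of_nonneg_left (hB x hx) (Real.sqrt_nonneg _))
    have := mul_le_mul_of_nonneg_left this (abs_nonneg (σ x))
    linarith
  rw [e1]
  have b1 := neg_abs_le (ρ x * ∑ i, w i x * g i x)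
  have b2 := neg_abs_le (σ x * ∑ i, w i x * h i x)
  linarith

theorem pressure (hΩ : IsOpen Ω) (hb : Bornology.IsBounded Ω) {w : Fin d → Euc d → ℝ}
    {q : Euc d → ℝ} (hw : ∀ i, Nice Ω (w i)) (hv : ∀ i, Van Ω (w i)) (hq : Nice Ω q)
    (hdiv : ∀ x ∈ Ω, ∑ i, pd i (w i) x = 0) :
    ∑ i, ∫ x in Ω, w i x * pd i q x = 0 := by
  rw [Finset.sum_congr rfl fun i _ => ibp hΩ hb (hw i) (hv i) hq i, Finset.sum_neg_distrib,
    ← integral_finsetSum _ (fun i _ => (((hw i).bm_pd i).mul (hq.bm hΩ)).int hΩ hb)]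
  rw [setIntegral_congr_fun (g := fun _ => 0) hΩ.measurableSet
    (fun x hx => by simp only [← Finset.sum_mul, hdiv x hx, zero_mul])]
  simp

end
end NPSaux

/-- velocity energy inequality: there is a constant `C > 0`, depending
only on the parameters and the domain, such that
`(1/2) d/dt ‖u - u*‖²_{L²} + ν‖∇(u - u*)‖²_{L²}
  ≤ C (‖c₁‖_{L^∞} + ‖c₂‖_{L^∞} + ‖∇Φ*‖_{L^∞})
     (‖c₁ - c₁*‖_{L²} + ‖c₂ - c₂*‖_{L²}) ‖∇(u - u*)‖_{L²}`. -/
theorem stmt_10 (d : ℕ) (hd : d = 2 ∨ d = 3) (Ω : Set (Euc d))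
    (hΩo : IsOpen Ω) (hΩc : IsConnected Ω) (hΩb : Bornology.IsBounded Ω)
    (D₁ D₂ ε ν K : ℝ) (hD₁ : 0 < D₁) (hD₂ : 0 < D₂) (hε : 0 < ε) (hν : 0 < ν) (hK : 0 < K) :
    ∃ C > (0 : ℝ), ∀ γ₁ γ₂ W : Euc d → ℝ, GoodData Ω γ₁ γ₂ W →
      ∀ (c₁ c₂ Φ : ℝ → Euc d → ℝ) (u : ℝ → Euc d → Euc d) (p : ℝ → Euc d → ℝ),
        TimeNPS D₁ D₂ ε ν K Ω γ₁ γ₂ W c₁ c₂ Φ u p →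
      ∀ (c₁s c₂s Φs : Euc d → ℝ) (us : Euc d → Euc d) (ps : Euc d → ℝ),
        SteadyNPS D₁ D₂ ε ν K Ω γ₁ γ₂ W c₁s c₂s Φs us ps →
      ∀ t > (0 : ℝ),
        (1/2) * deriv (fun s => ∫ x in Ω, ‖u s x - us x‖ ^ 2) t
            + ν * ∫ x in Ω, ‖fderiv ℝ (fun y => u t y - us y) x‖ ^ 2 ≤
          C * (supOn (c₁ t) Ω + supOn (c₂ t) Ω + supOn (gradient Φs) Ω)
            * (Real.sqrt (∫ x in Ω, (c₁ t x - c₁s x) ^ 2)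
                + Real.sqrt (∫ x in Ω, (c₂ t x - c₂s x) ^ 2))
            * Real.sqrt (∫ x in Ω, ‖fderiv ℝ (fun y => u t y - us y) x‖ ^ 2) := by
  have hd0 : 0 < d := by omega
  let i0 : Fin d := ⟨0, hd0⟩
  obtain ⟨R0, hR0⟩ := hΩb.exists_norm_le
  obtain ⟨R, hRpos, hR⟩ : ∃ R : ℝ, 0 < R ∧ ∀ x ∈ Ω, ‖x‖ ≤ R :=
    ⟨max R0 1, by positivity, fun x hx => (hR0 x hx).trans (le_max_left _ _)⟩
  refine ⟨K * ((2 * R) * ((2 * R) / ε) + 2 * R), by positivity, ?_⟩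
  intro γ₁ γ₂ W _ c₁ c₂ Φ u p H c₁s c₂s Φs us ps Hs t ht
  have slice : ∀ {F : Type} [NormedAddCommGroup F] [NormedSpace ℝ F] {f : ℝ → Euc d → F},
      ContDiffOn ℝ (⊤ : ℕ∞) (fun q : ℝ × Euc d => f q.1 q.2) (Set.Ici 0 ×ˢ closure Ω) →
      ContDiffOn ℝ (⊤ : ℕ∞) (f t) (closure Ω) := by
    intro F _ _ f hf
    exact hf.comp (g := fun q : ℝ × Euc d => f q.1 q.2) (f := fun x => (t, x))
      (contDiff_prodMk_right t).contDiffOn (fun x hx => ⟨ht.le, hx⟩)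
  have sc1 := slice H.smooth_c₁
  have sc2 := slice H.smooth_c₂
  have sΦ := slice H.smooth_Φ
  have su := slice H.smooth_u
  have sp := slice H.smooth_p
  have comp : ∀ {v : Euc d → Euc d}, ContDiffOn ℝ (⊤ : ℕ∞) v (closure Ω) → ∀ i,
      ContDiffOn ℝ (⊤ : ℕ∞) (fun y => v y i) (closure Ω) := by
    intro v hv i
    exact (EuclideanSpace.proj i : Euc d →L[ℝ] ℝ).contDiff.comp_contDiffOn hv
  have sui := comp su
  have susi := comp Hs.smooth_u
  have nice : ∀ {f : Euc d → ℝ}, ContDiffOn ℝ (⊤ : ℕ∞) f (closure Ω) → NPSaux.Nice Ω f :=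
    fun hf => NPSaux.nice_of_smooth hΩo hΩb hf
  let w : Fin d → Euc d → ℝ := fun i x => u t x i - us x i
  have nw : ∀ i, NPSaux.Nice Ω (w i) := fun i => (nice (sui i)).sub (nice (susi i)) hΩo
  have vw : ∀ i, NPSaux.Van Ω (w i) := fun i =>
    ⟨(sui i).continuousOn.sub (susi i).continuousOn, fun x hx => by
      simp [w, H.bc_u t ht.le x hx, Hs.bc_u x hx]⟩
  have vψ : NPSaux.Van Ω (fun x => Φ t x - Φs x) :=
    ⟨sΦ.continuousOn.sub Hs.smooth_Φ.continuousOn, fun x hx => by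
      simp [H.bc_Φ t ht.le x hx, Hs.bc_Φ x hx]⟩
  have bc1 := (nice sc1).bm hΩo
  have bc2 := (nice sc2).bm hΩo
  have bc1s := (nice Hs.smooth_c₁).bm hΩo
  have bc2s := (nice Hs.smooth_c₂).bm hΩo
  let ρ : Euc d → ℝ := fun x => c₁ t x - c₂ t x
  let σ : Euc d → ℝ := fun x => (c₁ t x - c₁s x) - (c₂ t x - c₂s x)
  have bρ : NPSaux.BM Ω ρ := bc1.sub bc2
  have bσ : NPSaux.BM Ω σ := (bc1.sub bc1s).sub (bc2.sub bc2s)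
  -- derivative of the velocity difference
  have dv : ∀ x ∈ Ω, DifferentiableAt ℝ (fun y => u t y - us y) x := fun x hx =>
    (((su.sub Hs.smooth_u).mono subset_closure).differentiableOn (by simp) x hx).differentiableAt
      (hΩo.mem_nhds hx)
  have pdw : ∀ x ∈ Ω, ∀ i j, NPSaux.pd j (w i) x =
      fderiv ℝ (fun y => u t y - us y) x (EuclideanSpace.single j 1) i := fun x hx i j =>
    NPSaux.pd_comp (v := fun y => u t y - us y) (dv x hx) i j
  have bD : NPSaux.BM Ω (fun x => ‖fderiv ℝ (fun y => u t y - us y) x‖) := by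
    refine ⟨(measurable_fderiv ℝ _).norm.aestronglyMeasurable, ?_⟩
    obtain ⟨M, hM⟩ := NPSaux.norm_fderiv_bdd (su.sub Hs.smooth_u) hΩb.isCompact_closure subset_rfl
    refine ⟨M, fun x hx => ?_⟩
    rw [norm_norm]
    exact hM x (subset_closure hx) (NPSaux.sub_int hΩo hx)
  set G := ∫ x in Ω, ‖fderiv ℝ (fun y => u t y - us y) x‖ ^ 2 with hG
  have hG0 : 0 ≤ G := integral_nonneg fun x => sq_nonneg _
  have iD := bD.sq.int hΩo hΩb
  -- G ≤ Hilbert-Schmidt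
  have hGHS : G ≤ ∑ i, ∫ x in Ω, ∑ j, NPSaux.pd j (w i) x ^ 2 := by
    have b : ∀ i, NPSaux.BM Ω (fun x => ∑ j, NPSaux.pd j (w i) x ^ 2) := fun i =>
      NPSaux.BM.sum Finset.univ fun j _ => ((nw i).bm_pd j).sq
    rw [← integral_finsetSum _ (fun i _ => (b i).int hΩo hΩb)]
    refine setIntegral_mono_on iD ((NPSaux.BM.sum Finset.univ fun i _ => b i).int hΩo hΩb)
      hΩo.measurableSet fun x hx => ?_
    simp only [pdw x hx]
    exact NPSaux.opnorm_le _
  -- Poincare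
  have hPw : √(∫ x in Ω, ∑ i, w i x ^ 2) ≤ 2 * R * √G := by
    rw [Real.sqrt_le_left (by positivity), mul_pow, Real.sq_sqrt hG0,
      integral_finsetSum _ (fun i _ => ((nw i).bm hΩo).sq.int hΩo hΩb)]
    refine (Finset.sum_le_sum fun i _ => NPSaux.poincare hΩo hΩb (nw i) (vw i) i0 hR).trans ?_
    rw [← Finset.mul_sum]
    refine mul_le_mul_of_nonneg_left ?_ (by positivity)
    rw [← integral_finsetSum _ (fun i _ => ((nw i).bm_pd i0).sq.int hΩo hΩb)]
    refine setIntegral_mono_on ((NPSaux.BM.sum Finset.univ fun i _ => ((nw i).bm_pd i0).sq).int hΩo hΩb)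
      iD hΩo.measurableSet fun x hx => ?_
    simp only [pdw x hx]
    exact NPSaux.le_opnorm_col _ i0
  -- elliptic
  have hE := NPSaux.elliptic hΩo hΩb sΦ Hs.smooth_Φ vψ bσ hε (fun x hx => by
    have h1 := H.eq_Φ t ht.le x hx
    have h2 := Hs.eq_Φ x hx
    simp only [σ]
    linarith) i0 hRpos hR
  have hM := NPSaux.minkowski hΩo hΩb (bc1.sub bc1s) (bc2.sub bc2s)
  -- sup norms
  have le_sup : ∀ {f : Euc d → ℝ}, NPSaux.Nice Ω f → ∀ x ∈ Ω, |f x| ≤ supOn f Ω := by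
    intro f hf x hx
    obtain ⟨M, hM⟩ := hf.2.1
    refine le_csSup ⟨M, ?_⟩ ⟨x, hx, rfl⟩
    rintro _ ⟨y, hy, rfl⟩
    exact hM y hy
  have sup_nonneg' : ∀ {F : Type} [NormedAddCommGroup F] (f : Euc d → F), 0 ≤ supOn f Ω := by
    intro F _ f
    refine Real.sSup_nonneg ?_
    rintro _ ⟨y, hy, rfl⟩
    exact norm_nonneg _
  set A1 := supOn (c₁ t) Ω with hA1
  set A2 := supOn (c₂ t) Ω with hA2
  set B := supOn (gradient Φs) Ω with hB
  have hA10 : 0 ≤ A1 := sup_nonneg' _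
  have hA20 : 0 ≤ A2 := sup_nonneg' _
  have hB0 : 0 ≤ B := sup_nonneg' _
  have hρA : ∀ x ∈ Ω, |ρ x| ≤ A1 + A2 := fun x hx =>
    (abs_sub _ _).trans (add_le_add (le_sup (nice sc1) x hx) (le_sup (nice sc2) x hx))
  have hgB : ∀ x ∈ Ω, √(∑ i, NPSaux.pd i Φs x ^ 2) ≤ B := by
    intro x hx
    have e : ∀ y, √(∑ i, NPSaux.pd i Φs y ^ 2) = ‖gradient Φs y‖ := fun y => by
      rw [EuclideanSpace.norm_eq]
      simp [NPSaux.gradient_apply]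
    rw [e]
    obtain ⟨M, hM⟩ := (nice Hs.smooth_Φ).2.2
    refine le_csSup ⟨M, ?_⟩ ⟨x, hx, rfl⟩
    rintro _ ⟨y, hy, rfl⟩
    refine le_trans (le_of_eq ?_) (hM y hy)
    exact LinearIsometryEquiv.norm_map (InnerProductSpace.toDual ℝ (Euc d)).symm (fderiv ℝ Φs y)
  have nψ := (nice sΦ).sub (nice Hs.smooth_Φ) hΩo
  have hF := NPSaux.force hΩo hΩb (fun i => (nw i).bm hΩo) (fun i => nψ.bm_pd i)
    (fun i => (nice Hs.smooth_Φ).bm_pd i) bρ bσ hρA hgB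
  -- time derivative
  obtain ⟨bdt, hdt⟩ := NPSaux.time_deriv hΩo hΩb H.smooth_u Hs.smooth_u ht
  have hdiv : ∀ x ∈ Ω, ∑ i, NPSaux.pd i (w i) x = 0 := by
    intro x hx
    have h1 := H.eq_div t ht.le x hx
    have h2 := Hs.eq_div x hx
    have d1 : DifferentiableAt ℝ (u t) x :=
      ((su.mono subset_closure).differentiableOn (by simp) x hx).differentiableAt (hΩo.mem_nhds hx)
    have d2 : DifferentiableAt ℝ us x :=
      ((Hs.smooth_u.mono subset_closure).differentiableOn (by simp) x hx).differentiableAt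
        (hΩo.mem_nhds hx)
    unfold vdiv at h1 h2
    rw [← sub_eq_zero.2 (h1.trans h2.symm), ← Finset.sum_sub_distrib]
    refine Finset.sum_congr rfl fun i _ => ?_
    rw [NPSaux.pd_sub (nice (sui i)) (nice (susi i)) hΩo i hx, NPSaux.pd_comp d1, NPSaux.pd_comp d2]
  have hp1 := NPSaux.pressure hΩo hΩb nw vw (nice sp) hdiv
  have hp2 := NPSaux.pressure hΩo hΩb nw vw (nice Hs.smooth_p) hdiv
  have hmain : (1/2) * deriv (fun s => ∫ x in Ω, ‖u s x - us x‖ ^ 2) t =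
      -(ν * ∑ i, ∫ x in Ω, ∑ j, NPSaux.pd j (w i) x ^ 2) +
      K * (-∫ x in Ω, ∑ i, w i x * (ρ x * NPSaux.pd i (fun x => Φ t x - Φs x) x
        + σ x * NPSaux.pd i Φs x)) := by
    rw [hdt.deriv, integral_const_mul]
    rw [integral_finsetSum _ (fun i _ => (((nw i).bm hΩo).mul (bdt i)).int hΩo hΩb)]
    have bf : ∀ i, NPSaux.BM Ω (fun x => w i x * (ρ x * NPSaux.pd i (fun x => Φ t x - Φs x) x
        + σ x * NPSaux.pd i Φs x)) := fun i => ((nw i).bm hΩo).mul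
      ((bρ.mul (nψ.bm_pd i)).add (bσ.mul ((nice Hs.smooth_Φ).bm_pd i)))
    rw [integral_finsetSum _ (fun i _ => (bf i).int hΩo hΩb)]
    have hi : ∀ i, ∫ x in Ω, w i x * deriv (fun s => u s x i) t =
        -(ν * ∫ x in Ω, ∑ j, NPSaux.pd j (w i) x ^ 2)
        - (∫ x in Ω, w i x * NPSaux.pd i (p t) x)
        + (∫ x in Ω, w i x * NPSaux.pd i ps x)
        - K * ∫ x in Ω, w i x * (ρ x * NPSaux.pd i (fun x => Φ t x - Φs x) x
          + σ x * NPSaux.pd i Φs x) := by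
      intro i
      have j1 := ((((nw i).bm hΩo).mul ((NPSaux.bm_lap hΩo hΩb (sui i)).sub
        (NPSaux.bm_lap hΩo hΩb (susi i)))).int hΩo hΩb).const_mul ν
      have j2 := (((nw i).bm hΩo).mul ((nice sp).bm_pd i)).int hΩo hΩb
      have j3 := (((nw i).bm hΩo).mul ((nice Hs.smooth_p).bm_pd i)).int hΩo hΩb
      have j4 := ((bf i).int hΩo hΩb).const_mul K
      have hlap : ∫ x in Ω, w i x * (lap (fun y => u t y i) x - lap (fun y => us y i) x) =
          -∫ x in Ω, ∑ j, NPSaux.pd j (w i) x ^ 2 :=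
        NPSaux.ibp_lap_sub hΩo hΩb (sui i) (susi i) (vw i)
      rw [← mul_neg, ← hlap,
        ← integral_const_mul, ← integral_const_mul, NPSaux.lin4 j1 j2 j3 j4]
      refine setIntegral_congr_fun hΩo.measurableSet fun x hx => ?_
      have h1 := H.eq_u t ht x hx i
      have h2 := Hs.eq_u x hx i
      rw [NPSaux.gradient_apply, NPSaux.gradient_apply] at h1 h2
      have h3 := NPSaux.pd_sub (nice sΦ) (nice Hs.smooth_Φ) hΩo i hx
      simp only [h3]
      have h4 : deriv (fun s => u s x i) t = ν * lap (fun y => u t y i) x - NPSaux.pd i (p t) x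
        - (K * (c₁ t x - c₂ t x)) * NPSaux.pd i (Φ t) x := by linarith
      have h5 : 0 = ν * lap (fun y => us y i) x - NPSaux.pd i ps x
        - (K * (c₁s x - c₂s x)) * NPSaux.pd i Φs x := by linarith
      have h6 := congrArg (fun z => w i x * z) h5
      simp only [mul_zero] at h6
      rw [h4]
      simp only [w, ρ, σ] at h6 ⊢
      linear_combination -h6
    have e2 : ∑ i, ∫ x in Ω, (u t x i - us x i) * deriv (fun s => u s x i) t =
      ∑ i, ∫ x in Ω, w i x * deriv (fun s => u s x i) t := rfl
    rw [e2, Finset.sum_congr rfl fun i _ => hi i]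
    simp only [Finset.sum_sub_distrib, Finset.sum_add_distrib, Finset.sum_neg_distrib,
      ← Finset.mul_sum, hp1, hp2]
    ring
  rw [hmain]
  set S1 := √(∫ x in Ω, (c₁ t x - c₁s x) ^ 2)
  set S2 := √(∫ x in Ω, (c₂ t x - c₂s x) ^ 2)
  set S := √(∫ x in Ω, σ x ^ 2)
  set X := √(∫ x in Ω, ∑ j, NPSaux.pd j (fun x => Φ t x - Φs x) x ^ 2)
  set Y := √(∫ x in Ω, ∑ i, w i x ^ 2)
  have hS : S ≤ S1 + S2 := hM
  have hS0 : 0 ≤ S := Real.sqrt_nonneg _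
  have hX0 : 0 ≤ X := Real.sqrt_nonneg _
  have hg0 : 0 ≤ √G := Real.sqrt_nonneg _
  have hE' : X ≤ 2 * R / ε * (S1 + S2) := hE.trans (mul_le_mul_of_nonneg_left hS (by positivity))
  have hS12 : 0 ≤ S1 + S2 := hS0.trans hS
  have t1 : Y * X ≤ (2 * R * √G) * (2 * R / ε * (S1 + S2)) := mul_le_mul hPw hE' hX0 (by positivity)
  have t2 : Y * S ≤ (2 * R * √G) * (S1 + S2) := mul_le_mul hPw hS hS0 (by positivity)
  have t3 := hF.trans (add_le_add (mul_le_mul_of_nonneg_left t1 (add_nonneg hA10 hA20))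
    (mul_le_mul_of_nonneg_left t2 hB0))
  have t4 : (A1 + A2) * ((2 * R * √G) * (2 * R / ε * (S1 + S2))) + B * ((2 * R * √G) * (S1 + S2)) ≤
      ((2 * R) * ((2 * R) / ε) + 2 * R) * (A1 + A2 + B) * (S1 + S2) * √G := by
    have p1 : 0 ≤ (A1 + A2) * (2 * R * √G * (S1 + S2)) := by positivity
    have p2 : 0 ≤ B * ((2 * R * √G) * (2 * R / ε * (S1 + S2))) := by positivity
    linarith
  have t5 := mul_le_mul_of_nonneg_left (t3.trans t4) hK.le
  have t6 := mul_le_mul_of_nonneg_left hGHS hν.le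
  linarith
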